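/- There exist constants c, C > 0 such that for every integer N ≥ 2, c·log N ≤ ∑_{n₁, n₂ ∈ ℤ³, ‖n₁‖_∞ ≤ N, ‖n₂‖_∞ ≤ N} ⟨n₁ + n₂⟩^(−2) ⟨n₁⟩^(−2) ⟨n₂⟩^(−2) ≤ C·log N, where ‖m‖_∞ = max(|m₁|,|m₂|,|m₃|) for m = (m₁,m₂,m₃) ∈ ℤ³. -/

import Mathlib

open scoped BigOperators

/-- The Japanese bracket `⟨m⟩ = (1 + |m|²)^{1/2}` of `m ∈ ℤ³`,
where `|m|` is the Euclidean norm. -/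
noncomputable def japaneseBracket (m : Fin 3 → ℤ) : ℝ :=
  (1 + ∑ i, ((m i : ℝ)) ^ 2) ^ ((1 : ℝ) / 2)

namespace LogDiv

/-- The cube of radius `n`. -/
noncomputable abbrev B (n : ℕ) : Finset (Fin 3 → ℤ) :=
  Finset.Icc (fun _ : Fin 3 => -(n : ℤ)) (fun _ : Fin 3 => (n : ℤ))

/-- The sup norm. -/
def r (m : Fin 3 → ℤ) : ℕ := Finset.univ.sup (fun i => (m i).natAbs)

noncomputable def w (m : Fin 3 → ℤ) : ℝ := japaneseBracket m ^ (-2 : ℝ)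

noncomputable def u (m : Fin 3 → ℤ) : ℝ := (((r m : ℝ) + 1) ^ 2)⁻¹

lemma r_le_iff (m : Fin 3 → ℤ) (n : ℕ) : r m ≤ n ↔ ∀ i, (m i).natAbs ≤ n := by
  simp [r]

lemma natAbs_le_r (m : Fin 3 → ℤ) (i : Fin 3) : (m i).natAbs ≤ r m :=
  (r_le_iff m _).1 le_rfl i

lemma mem_B (m : Fin 3 → ℤ) (n : ℕ) : m ∈ B n ↔ r m ≤ n := by
  rw [r_le_iff, Finset.mem_Icc, Pi.le_def, Pi.le_def, ← forall_and]
  refine forall_congr' fun i => ?_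
  constructor
  · rintro ⟨h1, h2⟩; omega
  · intro h; omega

lemma card_B (n : ℕ) : (B n).card = (2 * n + 1) ^ 3 := by
  rw [Pi.card_Icc]
  simp only [Int.card_Icc, Finset.prod_const, Finset.card_univ, Fintype.card_fin]
  congr 1
  omega

lemma r_add_le (a b : Fin 3 → ℤ) : r (a + b) ≤ r a + r b := by
  rw [r_le_iff]
  intro i
  have h1 := natAbs_le_r a i
  have h2 := natAbs_le_r b i
  simp only [Pi.add_apply]
  omega

/-- The sphere of radius `n`. -/
noncomputable def S (n : ℕ) : Finset (Fin 3 → ℤ) := (B n).filter (fun m => r m = n)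

lemma mem_S (m : Fin 3 → ℤ) (n : ℕ) : m ∈ S n ↔ r m = n := by
  simp only [S, Finset.mem_filter, mem_B]
  omega

lemma card_S_zero : (S 0).card = 1 := by
  have : S 0 = B 0 := by
    ext m; rw [mem_S, mem_B]; omega
  rw [this, card_B]; norm_num

lemma card_S_succ (k : ℕ) : (S (k + 1)).card + (2 * k + 1) ^ 3 = (2 * k + 3) ^ 3 := by
  have h : S (k + 1) ∪ B k = B (k + 1) := by
    ext m; rw [Finset.mem_union, mem_S, mem_B, mem_B]; omega
  have hd : Disjoint (S (k + 1)) (B k) := by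
    rw [Finset.disjoint_left]; intro m h1 h2
    rw [mem_S] at h1; rw [mem_B] at h2; omega
  have := Finset.card_union_of_disjoint hd
  rw [h, card_B, card_B] at this
  rw [← this]; ring

lemma card_S_le (k : ℕ) : (S k).card ≤ 26 * (k + 1) ^ 2 := by
  rcases k with _ | k
  · rw [card_S_zero]; norm_num
  · have := card_S_succ k
    generalize (S (k + 1)).card = c at *
    ring_nf at *
    nlinarith

lemma le_card_S (k : ℕ) : (k + 1) ^ 2 ≤ (S k).card := by
  rcases k with _ | k
  · rw [card_S_zero]; norm_num
  · have := card_S_succ k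
    generalize (S (k + 1)).card = c at *
    ring_nf at *
    nlinarith

lemma sum_B (n : ℕ) (f : (Fin 3 → ℤ) → ℝ) :
    ∑ m ∈ B n, f m = ∑ k ∈ Finset.range (n + 1), ∑ m ∈ S k, f m := by
  rw [← Finset.sum_fiberwise_of_maps_to (s := B n) (t := Finset.range (n + 1)) (g := r)]
  · refine Finset.sum_congr rfl fun k hk => Finset.sum_congr ?_ fun _ _ => rfl
    ext m
    rw [Finset.mem_filter, mem_S, mem_B]
    rw [Finset.mem_range] at hk
    omega
  · intro m hm
    rw [mem_B] at hm
    rw [Finset.mem_range]; omega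

lemma w_eq (m : Fin 3 → ℤ) : w m = (1 + ∑ i, ((m i : ℝ)) ^ 2)⁻¹ := by
  have h : (0 : ℝ) ≤ 1 + ∑ i, ((m i : ℝ)) ^ 2 := by positivity
  rw [w, japaneseBracket, ← Real.rpow_mul h, ← Real.rpow_neg_one]
  norm_num

lemma abs_le_r (m : Fin 3 → ℤ) (i : Fin 3) : (m i : ℝ) ^ 2 ≤ (r m : ℝ) ^ 2 := by
  have h : (((m i).natAbs : ℕ) : ℝ) ≤ r m := by exact_mod_cast natAbs_le_r m i
  rw [Nat.cast_natAbs] at h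
  push_cast at h
  rw [← sq_abs (m i : ℝ)]
  gcongr

lemma exists_r (m : Fin 3 → ℤ) : ∃ i, (m i : ℝ) ^ 2 = (r m : ℝ) ^ 2 := by
  obtain ⟨i, -, hi⟩ := Finset.exists_mem_eq_sup (Finset.univ : Finset (Fin 3))
    Finset.univ_nonempty (fun i => (m i).natAbs)
  refine ⟨i, ?_⟩
  rw [r, hi, Nat.cast_natAbs]
  push_cast
  rw [sq_abs]

lemma w_le (m : Fin 3 → ℤ) : w m ≤ 2 * u m := by
  obtain ⟨i, hi⟩ := exists_r m
  have h : (m i : ℝ) ^ 2 ≤ ∑ i, ((m i : ℝ)) ^ 2 :=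
    Finset.single_le_sum (f := fun i => ((m i : ℝ)) ^ 2) (fun _ _ => sq_nonneg _)
      (Finset.mem_univ i)
  rw [w_eq, u, ← div_eq_mul_inv, inv_eq_one_div, div_le_div_iff₀ (by positivity) (by positivity)]
  nlinarith [sq_nonneg ((r m : ℝ) - 1)]

lemma le_w (m : Fin 3 → ℤ) (k : ℕ) (h : r m ≤ k) : (3 * ((k : ℝ) + 1) ^ 2)⁻¹ ≤ w m := by
  rw [w_eq]
  have h0 := abs_le_r m 0
  have h1 := abs_le_r m 1
  have h2 := abs_le_r m 2
  have h3 : (r m : ℝ) ^ 2 ≤ (k : ℝ) ^ 2 := by gcongr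
  have hk : (0 : ℝ) ≤ k := by positivity
  apply inv_anti₀ (by positivity)
  rw [Fin.sum_univ_three]
  nlinarith

lemma w_nonneg (m : Fin 3 → ℤ) : 0 ≤ w m := by
  rw [w_eq]; positivity

lemma u_nonneg (m : Fin 3 → ℤ) : 0 ≤ u m := by
  rw [u]; positivity

lemma u_anti {a b : Fin 3 → ℤ} (h : r a ≤ r b) : u b ≤ u a := by
  rw [u, u]
  have : (r a : ℝ) ≤ r b := by exact_mod_cast h
  gcongr

noncomputable def g (x y : Fin 3 → ℤ) : ℝ := if r x ≤ r y then u x * u y ^ 2 else 0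

noncomputable def G (x y : Fin 3 → ℤ) : ℝ := g x y + g y x

lemma g_nonneg (x y : Fin 3 → ℤ) : 0 ≤ g x y := by
  have := u_nonneg x
  unfold g; split_ifs <;> positivity

lemma G_nonneg (x y : Fin 3 → ℤ) : 0 ≤ G x y := add_nonneg (g_nonneg _ _) (g_nonneg _ _)

lemma prod_le_g {x y z : Fin 3 → ℤ} (h : r x ≤ r y) (h' : r y ≤ r z) :
    u x * (u y * u z) ≤ g x y := by
  rw [g, if_pos h, sq]
  have := u_anti h'
  have := u_nonneg x
  have := u_nonneg y
  gcongr

lemma prod_le_G (x y z : Fin 3 → ℤ) :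
    u z * (u x * u y) ≤ G x y + G x z + G y z := by
  unfold G
  have a1 := g_nonneg x y
  have a2 := g_nonneg x z
  have a3 := g_nonneg y x
  have a4 := g_nonneg y z
  have a5 := g_nonneg z x
  have a6 := g_nonneg z y
  rcases le_total (r x) (r y) with h1 | h1 <;> rcases le_total (r y) (r z) with h2 | h2 <;>
    rcases le_total (r x) (r z) with h3 | h3
  · linarith [prod_le_g h1 h2]
  · linarith [prod_le_g h1 h2]
  · linarith [prod_le_g h3 h2]
  · linarith [prod_le_g h3 h1]
  · linarith [prod_le_g h1 h3]
  · linarith [prod_le_g h2 h3]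
  · linarith [prod_le_g h2 h1]
  · linarith [prod_le_g h2 h1]

lemma sum_u (k : ℕ) : ∑ x ∈ B k, u x ≤ 26 * ((k : ℝ) + 1) := by
  rw [sum_B]
  have : ∀ j ∈ Finset.range (k + 1), ∑ m ∈ S j, u m ≤ 26 := by
    intro j _
    have h1 : ∑ m ∈ S j, u m = (S j).card * (((j : ℝ) + 1) ^ 2)⁻¹ := by
      rw [← nsmul_eq_mul, ← Finset.sum_const]
      refine Finset.sum_congr rfl fun m hm => ?_
      rw [mem_S] at hm
      rw [u, hm]
    rw [h1, ← div_eq_mul_inv, div_le_iff₀ (by positivity)]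
    exact_mod_cast card_S_le j
  refine (Finset.sum_le_sum this).trans ?_
  simp; linarith

lemma sum_g_inner (n : ℕ) (y : Fin 3 → ℤ) :
    ∑ x ∈ B n, g x y ≤ 26 * (((r y : ℝ) + 1) ^ 3)⁻¹ := by
  have h1 : ∑ x ∈ B n, g x y ≤ ∑ x ∈ B (r y), u x * u y ^ 2 := by
    unfold g
    rw [← Finset.sum_filter]
    refine Finset.sum_le_sum_of_subset_of_nonneg ?_ ?_
    · intro m hm
      rw [Finset.mem_filter] at hm
      rw [mem_B]; exact hm.2
    · intro m _ _
      have := u_nonneg m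
      positivity
  refine h1.trans ?_
  rw [← Finset.sum_mul]
  calc _ ≤ (26 * ((r y : ℝ) + 1)) * u y ^ 2 := by
        gcongr
        exact sum_u _
    _ = _ := by
        rw [u]; field_simp

lemma sum_g (n : ℕ) :
    ∑ y ∈ B n, ∑ x ∈ B n, g x y ≤ 676 * (harmonic (n + 1) : ℝ) := by
  refine (Finset.sum_le_sum fun y _ => sum_g_inner n y).trans ?_
  rw [sum_B, harmonic]
  push_cast
  rw [Finset.mul_sum]
  refine Finset.sum_le_sum fun k _ => ?_
  have h1 : ∑ m ∈ S k, (26 : ℝ) * (((r m : ℝ) + 1) ^ 3)⁻¹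
      = (S k).card * (26 * (((k : ℝ) + 1) ^ 3)⁻¹) := by
    rw [← nsmul_eq_mul, ← Finset.sum_const]
    refine Finset.sum_congr rfl fun m hm => ?_
    rw [mem_S] at hm
    rw [hm]
  rw [h1]
  have h2 : ((S k).card : ℝ) ≤ 26 * ((k : ℝ) + 1) ^ 2 := by exact_mod_cast card_S_le k
  calc _ ≤ 26 * ((k : ℝ) + 1) ^ 2 * (26 * (((k : ℝ) + 1) ^ 3)⁻¹) := by gcongr
    _ = _ := by field_simp; norm_num

lemma sum_G (n : ℕ) :
    ∑ x ∈ B n, ∑ y ∈ B n, G x y ≤ 1352 * (harmonic (n + 1) : ℝ) := by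
  unfold G
  simp only [Finset.sum_add_distrib]
  rw [Finset.sum_comm]
  linarith [sum_g n]

lemma B_mono {n k : ℕ} (h : n ≤ k) : B n ⊆ B k := by
  intro m; rw [mem_B, mem_B]; omega

lemma sum_G1 (N : ℕ) :
    ∑ x ∈ B N, ∑ y ∈ B N, G x y ≤ ∑ x ∈ B (2 * N), ∑ y ∈ B (2 * N), G x y := by
  have h := B_mono (show N ≤ 2 * N by omega)
  calc _ ≤ ∑ x ∈ B N, ∑ y ∈ B (2 * N), G x y :=
        Finset.sum_le_sum fun x _ =>
          Finset.sum_le_sum_of_subset_of_nonneg h fun _ _ _ => G_nonneg _ _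
    _ ≤ _ := Finset.sum_le_sum_of_subset_of_nonneg h fun _ _ _ =>
        Finset.sum_nonneg fun _ _ => G_nonneg _ _

lemma sum_G2 (N : ℕ) :
    ∑ x ∈ B N, ∑ y ∈ B N, G x (x + y) ≤ ∑ x ∈ B (2 * N), ∑ y ∈ B (2 * N), G x y := by
  have h := B_mono (show N ≤ 2 * N by omega)
  calc _ ≤ ∑ x ∈ B N, ∑ y ∈ B (2 * N), G x y := by
        refine Finset.sum_le_sum fun x hx => ?_
        have : ∑ y ∈ B N, G x (x + y) = ∑ z ∈ (B N).image (fun y => x + y), G x z := by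
          rw [Finset.sum_image]
          intro a _ b _ hab
          exact add_left_cancel hab
        rw [this]
        refine Finset.sum_le_sum_of_subset_of_nonneg ?_ fun _ _ _ => G_nonneg _ _
        intro z hz
        obtain ⟨y, hy, rfl⟩ := Finset.mem_image.1 hz
        rw [mem_B] at *
        have := r_add_le x y
        omega
    _ ≤ _ := Finset.sum_le_sum_of_subset_of_nonneg h fun _ _ _ =>
        Finset.sum_nonneg fun _ _ => G_nonneg _ _

lemma upper (N : ℕ) :
    ∑ a ∈ B N, ∑ b ∈ B N, w (a + b) * (w a * w b)
      ≤ 8 * (3 * (1352 * (harmonic (2 * N + 1) : ℝ))) := by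
  have h3 : ∑ x ∈ B N, ∑ y ∈ B N, G y (x + y) ≤ 1352 * (harmonic (2 * N + 1) : ℝ) := by
    rw [Finset.sum_comm]
    simp only [add_comm]
    have := (sum_G2 N).trans (sum_G (2 * N))
    simpa only [add_comm] using this
  have h1 := (sum_G1 N).trans (sum_G (2 * N))
  have h2 := (sum_G2 N).trans (sum_G (2 * N))
  calc _ ≤ ∑ a ∈ B N, ∑ b ∈ B N, 8 * (G a b + G a (a + b) + G b (a + b)) := by
        refine Finset.sum_le_sum fun a _ => Finset.sum_le_sum fun b _ => ?_
        refine le_trans ?_ (mul_le_mul_of_nonneg_left (prod_le_G a b (a + b)) (by norm_num))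
        have ha := w_nonneg a
        have hb := w_nonneg b
        have hc := u_nonneg (a + b)
        have ha' := u_nonneg a
        calc _ ≤ (2 * u (a + b)) * ((2 * u a) * (2 * u b)) := by
              gcongr
              · exact w_le _
              · exact w_le _
              · exact w_le _
          _ = _ := by ring
    _ = 8 * (∑ a ∈ B N, ∑ b ∈ B N, G a b + ∑ a ∈ B N, ∑ b ∈ B N, G a (a + b)
          + ∑ a ∈ B N, ∑ b ∈ B N, G b (a + b)) := by
        simp only [← Finset.mul_sum, Finset.sum_add_distrib]
    _ ≤ _ := by linarith

lemma lower (N : ℕ) :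
    (1 / 108) * (harmonic (N + 1) : ℝ) ≤ ∑ a ∈ B N, ∑ b ∈ B N, w (a + b) * (w a * w b) := by
  rw [sum_B, harmonic]
  push_cast
  rw [Finset.mul_sum]
  refine Finset.sum_le_sum fun k hk => ?_
  have hkN : k ≤ N := by rw [Finset.mem_range] at hk; omega
  have h1 : ∀ a ∈ S k, ((k : ℝ) + 1) ^ 3 * (108 * ((k : ℝ) + 1) ^ 6)⁻¹
      ≤ ∑ b ∈ B N, w (a + b) * (w a * w b) := by
    intro a ha
    rw [mem_S] at ha
    calc _ ≤ ∑ b ∈ B k, (108 * ((k : ℝ) + 1) ^ 6)⁻¹ := by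
          rw [Finset.sum_const, nsmul_eq_mul]
          gcongr
          rw [card_B]
          push_cast
          gcongr
          linarith [(Nat.cast_nonneg k : (0 : ℝ) ≤ k)]
      _ ≤ ∑ b ∈ B k, w (a + b) * (w a * w b) := by
          refine Finset.sum_le_sum fun b hb => ?_
          rw [mem_B] at hb
          have e1 := le_w a k ha.le
          have e2 := le_w b k hb
          have e3 := le_w (a + b) (2 * k + 1) (by have := r_add_le a b; omega)
          have hwa := w_nonneg a
          have hwc := w_nonneg (a + b)
          calc _ = (3 * (((2 * k + 1 : ℕ) : ℝ) + 1) ^ 2)⁻¹ *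
                  ((3 * ((k : ℝ) + 1) ^ 2)⁻¹ * (3 * ((k : ℝ) + 1) ^ 2)⁻¹) := by
                push_cast
                rw [← mul_inv, ← mul_inv]
                congr 1
                ring
            _ ≤ _ := by gcongr
      _ ≤ _ := Finset.sum_le_sum_of_subset_of_nonneg (B_mono hkN) fun b _ _ =>
          mul_nonneg (w_nonneg _) (mul_nonneg (w_nonneg _) (w_nonneg _))
  have h2 : ((k : ℝ) + 1) ^ 2 ≤ (S k).card := by exact_mod_cast le_card_S k
  calc _ = ((k : ℝ) + 1) ^ 2 * (((k : ℝ) + 1) ^ 3 * (108 * ((k : ℝ) + 1) ^ 6)⁻¹) := by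
        field_simp
    _ ≤ (S k).card * (((k : ℝ) + 1) ^ 3 * (108 * ((k : ℝ) + 1) ^ 6)⁻¹) := by gcongr
    _ = ∑ a ∈ S k, ((k : ℝ) + 1) ^ 3 * (108 * ((k : ℝ) + 1) ^ 6)⁻¹ := by
        rw [Finset.sum_const, nsmul_eq_mul]
    _ ≤ _ := Finset.sum_le_sum h1

end LogDiv

/-- Two-sided logarithmic bound (deterministic content of Lemmas 3.1(i) and 3.6):
`∑_{‖n₁‖_∞ ≤ N, ‖n₂‖_∞ ≤ N} ⟨n₁+n₂⟩^{-2} ⟨n₁⟩^{-2} ⟨n₂⟩^{-2} ∼ log N`. -/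
theorem log_divergence_sum :
    ∃ c C : ℝ, 0 < c ∧ 0 < C ∧ ∀ N : ℕ, 2 ≤ N →
      c * Real.log N ≤
        (∑ n₁ ∈ Finset.Icc (fun _ : Fin 3 => -(N : ℤ)) (fun _ : Fin 3 => (N : ℤ)),
          ∑ n₂ ∈ Finset.Icc (fun _ : Fin 3 => -(N : ℤ)) (fun _ : Fin 3 => (N : ℤ)),
            japaneseBracket (n₁ + n₂) ^ (-2 : ℝ) * (japaneseBracket n₁ ^ (-2 : ℝ) *
              japaneseBracket n₂ ^ (-2 : ℝ))) ∧
      (∑ n₁ ∈ Finset.Icc (fun _ : Fin 3 => -(N : ℤ)) (fun _ : Fin 3 => (N : ℤ)),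
          ∑ n₂ ∈ Finset.Icc (fun _ : Fin 3 => -(N : ℤ)) (fun _ : Fin 3 => (N : ℤ)),
            japaneseBracket (n₁ + n₂) ^ (-2 : ℝ) * (japaneseBracket n₁ ^ (-2 : ℝ) *
              japaneseBracket n₂ ^ (-2 : ℝ)))
        ≤ C * Real.log N := by
  refine ⟨1 / 108, 8 * (3 * (1352 * 6)), by norm_num, by norm_num, fun N hN => ⟨?_, ?_⟩⟩
  · refine le_trans ?_ (LogDiv.lower N)
    gcongr
    refine le_trans ?_ (log_add_one_le_harmonic (N + 1))
    apply Real.log_le_log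
    · positivity
    · push_cast; linarith
  · refine (LogDiv.upper N).trans ?_
    have h1 := harmonic_le_one_add_log (2 * N + 1)
    have hN' : (2 : ℝ) ≤ N := by exact_mod_cast hN
    have h2 : Real.log ((2 * N + 1 : ℕ) : ℝ) ≤ 3 * Real.log N := by
      have e : 3 * Real.log N = Real.log ((N : ℝ) ^ 3) := by
        rw [Real.log_pow]; norm_num
      rw [e]
      apply Real.log_le_log
      · positivity
      · push_cast
        nlinarith [mul_le_mul hN' hN' (by norm_num) (by linarith), sq_nonneg (N : ℝ)]
    have h3 : Real.log 2 ≤ Real.log N := Real.log_le_log (by norm_num) hN'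
    have h4 := Real.log_two_gt_d9
    linarith
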